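/- arXiv:math/0512243 — 6 statements merged into one kernel-verified Lean document; each statement's English description precedes it below -/
import Mathlib

section
/- Let α ∈ ℝ, let I ⊆ ℝ be an open interval, and let q, p : ℝ → ℝ be differentiable on I satisfying the Hamiltonian system q'(t) = −q(t)² + p(t) − t/2 and p'(t) = 2p(t)q(t) + (α + 1/2) for all t ∈ I, and assume p(t) ≠ 0 for all t ∈ I. Then p is twice differentiable on I and satisfies the thirty-fourth Painlevé equation P34((α+1/2)²): p''(t) = p'(t)²/(2p(t)) + 2p(t)² − t·p(t) − (α+1/2)²/(2p(t)) for all t ∈ I. -/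
/-- Eliminating `q` from the Hamiltonian system for P2(α) yields the
thirty-fourth Painlevé equation P34((α+1/2)²) for `p`. -/
theorem stmt_2 (α a b : ℝ) (q p : ℝ → ℝ)
    (hq : ∀ t ∈ Set.Ioo a b, DifferentiableAt ℝ q t)
    (hp : ∀ t ∈ Set.Ioo a b, DifferentiableAt ℝ p t)
    (hq' : ∀ t ∈ Set.Ioo a b, deriv q t = -(q t) ^ 2 + p t - t / 2)
    (hp' : ∀ t ∈ Set.Ioo a b, deriv p t = 2 * p t * q t + (α + 1 / 2))
    (hpne : ∀ t ∈ Set.Ioo a b, p t ≠ 0) :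
    (∀ t ∈ Set.Ioo a b, DifferentiableAt ℝ (deriv p) t) ∧
    (∀ t ∈ Set.Ioo a b,
      deriv (deriv p) t
        = (deriv p t) ^ 2 / (2 * p t) + 2 * (p t) ^ 2 - t * p t
          - (α + 1 / 2) ^ 2 / (2 * p t)) := by
  have key : ∀ t ∈ Set.Ioo a b, HasDerivAt (deriv p)
      (2 * deriv p t * q t + 2 * p t * deriv q t) t := by
    intro t ht
    have h := ((((hp t ht).hasDerivAt.const_mul 2).mul (hq t ht).hasDerivAt).add_const
      (α + 1 / 2))
    refine h.congr_of_eventuallyEq ?_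
    filter_upwards [isOpen_Ioo.mem_nhds ht] with s hs
    simpa using hp' s hs
  refine ⟨fun t ht => (key t ht).differentiableAt, fun t ht => ?_⟩
  have hne := hpne t ht
  rw [(key t ht).deriv, hq' t ht, hp' t ht]
  field_simp
  ring
end

section
/- Let α ∈ ℝ, let I ⊆ ℝ be an open interval, and let y : ℝ → ℝ be twice differentiable on I satisfying the second Painlevé equation P2(α): y''(t) = 2y(t)³ + t·y(t) + α on I. Define w(t) = y'(t) + y(t)² + t/2 and assume w(t) ≠ 0 for all t ∈ I. Then w is twice differentiable on I and satisfies the thirty-fourth Painlevé equation P34((α+1/2)²): w''(t) = w'(t)²/(2w(t)) + 2w(t)² − t·w(t) − (α+1/2)²/(2w(t)) for all t ∈ I. -/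
/-- The map `y ↦ y' + y² + t/2` sends solutions of P2(α) to solutions of
P34((α+1/2)²). -/
theorem stmt_3 (α a b : ℝ) (y : ℝ → ℝ)
    (hy1 : ∀ t ∈ Set.Ioo a b, DifferentiableAt ℝ y t)
    (hy2 : ∀ t ∈ Set.Ioo a b, DifferentiableAt ℝ (deriv y) t)
    (hy : ∀ t ∈ Set.Ioo a b,
      deriv (deriv y) t = 2 * (y t) ^ 3 + t * y t + α)
    (w : ℝ → ℝ)
    (hw : ∀ t ∈ Set.Ioo a b, w t = deriv y t + (y t) ^ 2 + t / 2)
    (hwne : ∀ t ∈ Set.Ioo a b, w t ≠ 0) :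
    (∀ t ∈ Set.Ioo a b, DifferentiableAt ℝ w t) ∧
    (∀ t ∈ Set.Ioo a b, DifferentiableAt ℝ (deriv w) t) ∧
    (∀ t ∈ Set.Ioo a b,
      deriv (deriv w) t
        = (deriv w t) ^ 2 / (2 * w t) + 2 * (w t) ^ 2 - t * w t
          - (α + 1 / 2) ^ 2 / (2 * w t)) := by
  have nhds_Ioo : ∀ t ∈ Set.Ioo a b, Set.Ioo a b ∈ nhds t :=
    fun t ht => isOpen_Ioo.mem_nhds ht
  have hw' : ∀ t ∈ Set.Ioo a b, HasDerivAt w (2 * y t * w t + (α + 1 / 2)) t := by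
    intro t ht
    have h := (((hy2 t ht).hasDerivAt.add ((hy1 t ht).hasDerivAt.pow 2)).add
      ((hasDerivAt_id t).div_const 2)).congr_of_eventuallyEq
        (f₁ := w) (Filter.mem_of_superset (nhds_Ioo t ht) fun s hs => by simpa using hw s hs)
    refine h.congr_deriv ?_
    rw [hy t ht, hw t ht]
    push_cast
    ring
  have hw'' : ∀ t ∈ Set.Ioo a b, HasDerivAt (deriv w)
      (2 * deriv y t * w t + 2 * y t * (2 * y t * w t + (α + 1 / 2))) t := by
    intro t ht
    exact ((((hy1 t ht).hasDerivAt.const_mul 2).mul (hw' t ht)).add_const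
      (α + 1 / 2)).congr_of_eventuallyEq
        (Filter.mem_of_superset (nhds_Ioo t ht) fun s hs => by simpa using (hw' s hs).deriv)
  refine ⟨fun t ht => (hw' t ht).differentiableAt,
    fun t ht => (hw'' t ht).differentiableAt, fun t ht => ?_⟩
  have hne := hwne t ht
  have hy' : deriv y t = w t - (y t) ^ 2 - t / 2 := by
    rw [hw t ht]
    ring
  rw [(hw'' t ht).deriv, (hw' t ht).deriv, hy']
  field_simp
  ring
end

section
/- Let s ∈ ℝ, let I ⊆ ℝ be an open interval, and let u : ℝ → ℝ be twice differentiable on I with u(t) ≠ 0 and u'(t) ≠ 0 for all t ∈ I, satisfying the Hermite–Weber equation u''(t) + 2t·u'(t) + 2s·u(t) = 0 on I. Then y(t) = u'(t)/u(t) is twice differentiable on I and satisfies the fourth Painlevé equation P4(1−s, −2s²): y''(t) = y'(t)²/(2y(t)) + (3/2)·y(t)³ + 4t·y(t)² + 2(t² − (1−s))·y(t) + (−2s²)/y(t) for all t ∈ I. -/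
/-- The logarithmic derivative of a solution of the Hermite–Weber equation satisfies the
Riccati equation `y' = -(y² + 2ty + 2s)`. -/
theorem hasDerivAt_riccati_of_hermiteWeber {s t : ℝ} {S : Set ℝ} {u y : ℝ → ℝ} (hS : S ∈ nhds t)
    (hu1 : DifferentiableAt ℝ u t) (hu2 : DifferentiableAt ℝ (deriv u) t) (hune : u t ≠ 0)
    (hu : deriv (deriv u) t + 2 * t * deriv u t + 2 * s * u t = 0)
    (hy : ∀ x ∈ S, y x = deriv u x / u x) :
    HasDerivAt y (-(y t ^ 2 + 2 * t * y t + 2 * s)) t := by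
  have hquot := (hu2.hasDerivAt.div hu1.hasDerivAt hune).congr_of_eventuallyEq
    (Filter.eventuallyEq_of_mem hS hy)
  refine hquot.congr_deriv ?_
  rw [hy t (mem_of_mem_nhds hS)]
  field_simp
  linear_combination u t * hu

/-- The second derivative of a solution of the Riccati equation `y' = -(y² + 2ty + 2s)`. -/
theorem hasDerivAt_deriv_of_riccati {s t : ℝ} {S : Set ℝ} {y : ℝ → ℝ} (hS : S ∈ nhds t)
    (hd : ∀ x ∈ S, HasDerivAt y (-(y x ^ 2 + 2 * x * y x + 2 * s)) x) :
    HasDerivAt (deriv y) (2 * (y t + t) * (y t ^ 2 + 2 * t * y t + 2 * s) - 2 * y t) t := by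
  have hyt := hd t (mem_of_mem_nhds hS)
  have hriccati : HasDerivAt (fun x => -(y x ^ 2 + 2 * x * y x + 2 * s)) _ t :=
    (((hyt.fun_pow 2).fun_add (((hasDerivAt_id' t).const_mul 2).fun_mul hyt)).add_const
      (2 * s)).fun_neg
  refine (hriccati.congr_of_eventuallyEq
    (Filter.eventuallyEq_of_mem hS fun x hx => (hd x hx).deriv)).congr_deriv ?_
  norm_num
  ring


/-- P4(1−s, −2s²) has Riccati-type solutions `y = u'/u` built from solutions
of the Hermite–Weber equation `u'' + 2t·u' + 2s·u = 0`. -/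
theorem stmt_6 (s a b : ℝ) (u : ℝ → ℝ)
    (hu1 : ∀ t ∈ Set.Ioo a b, DifferentiableAt ℝ u t)
    (hu2 : ∀ t ∈ Set.Ioo a b, DifferentiableAt ℝ (deriv u) t)
    (hune : ∀ t ∈ Set.Ioo a b, u t ≠ 0)
    (hu'ne : ∀ t ∈ Set.Ioo a b, deriv u t ≠ 0)
    (hu : ∀ t ∈ Set.Ioo a b,
      deriv (deriv u) t + 2 * t * deriv u t + 2 * s * u t = 0)
    (y : ℝ → ℝ)
    (hy : ∀ t ∈ Set.Ioo a b, y t = deriv u t / u t) :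
    (∀ t ∈ Set.Ioo a b, DifferentiableAt ℝ y t) ∧
    (∀ t ∈ Set.Ioo a b, DifferentiableAt ℝ (deriv y) t) ∧
    (∀ t ∈ Set.Ioo a b,
      deriv (deriv y) t
        = (deriv y t) ^ 2 / (2 * y t) + (3 / 2) * (y t) ^ 3
          + 4 * t * (y t) ^ 2 + 2 * (t ^ 2 - (1 - s)) * y t
          + (-2 * s ^ 2) / y t) := by
  have hne : ∀ t ∈ Set.Ioo a b, y t ≠ 0 := fun t ht => by
    rw [hy t ht]
    exact div_ne_zero (hu'ne t ht) (hune t ht)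
  have hd : ∀ t ∈ Set.Ioo a b, HasDerivAt y (-(y t ^ 2 + 2 * t * y t + 2 * s)) t :=
    fun t ht => hasDerivAt_riccati_of_hermiteWeber (isOpen_Ioo.mem_nhds ht) (hu1 t ht)
      (hu2 t ht) (hune t ht) (hu t ht) hy
  have hdd : ∀ t ∈ Set.Ioo a b, HasDerivAt (deriv y)
      (2 * (y t + t) * (y t ^ 2 + 2 * t * y t + 2 * s) - 2 * y t) t :=
    fun t ht => hasDerivAt_deriv_of_riccati (isOpen_Ioo.mem_nhds ht) hd
  refine ⟨fun t ht => (hd t ht).differentiableAt, fun t ht => (hdd t ht).differentiableAt,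
    fun t ht => ?_⟩
  have := hne t ht
  rw [(hdd t ht).deriv, (hd t ht).deriv]
  field_simp
  ring
end

section
/- Let h ∈ ℝ with h ≠ 0. The function y(t) = 1 + 2√t/h satisfies the degenerate fifth Painlevé equation deg-P5(h²/2, −1/8, −2, 0) on the set of t > 0 where y(t) ≠ 0 and y(t) ≠ 1: there, y''(t) = (1/(2y(t)) + 1/(y(t)−1))·y'(t)² − y'(t)/t + ((y(t)−1)²/t²)·((h²/2)·y(t) + (−1/8)/y(t)) + (−2)·y(t)/t. -/
/-- On the positive half-line, `1 + 2√t/h` has derivative `1/(h√t)`. -/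
lemma hasDerivAt_one_add_two_mul_sqrt_div (h : ℝ) {t : ℝ} (ht : 0 < t) :
    HasDerivAt (fun t => 1 + 2 * Real.sqrt t / h) (h⁻¹ * (Real.sqrt t)⁻¹) t := by
  have hs : Real.sqrt t ≠ 0 := (Real.sqrt_pos.2 ht).ne'
  refine ((((Real.hasDerivAt_sqrt ht.ne').const_mul 2).div_const h).const_add 1).congr_deriv ?_
  field_simp

/-- `y(t) = 1 + 2√t/h` is an algebraic solution of the degenerate fifth
Painlevé equation deg-P5(h²/2, −1/8, −2, 0), at points `t > 0` where
`y(t) ≠ 0` and `y(t) ≠ 1`. -/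
theorem stmt_13 (h : ℝ) (hh : h ≠ 0) (y : ℝ → ℝ)
    (hy : ∀ t, y t = 1 + 2 * Real.sqrt t / h) :
    ∀ t ∈ Set.Ioi (0 : ℝ), y t ≠ 0 → y t ≠ 1 →
      deriv (deriv y) t
        = (1 / (2 * y t) + 1 / (y t - 1)) * (deriv y t) ^ 2 - deriv y t / t
          + ((y t - 1) ^ 2 / t ^ 2) * ((h ^ 2 / 2) * y t + (-1 / 8) / y t)
          + (-2) * y t / t := by
  intro t ht hy0 _
  have ht : 0 < t := ht
  have hs : Real.sqrt t ≠ 0 := (Real.sqrt_pos.2 ht).ne'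
  have hderiv : ∀ u, 0 < u → deriv y u = h⁻¹ * (Real.sqrt u)⁻¹ := fun u hu => by
    rw [funext hy]
    exact (hasDerivAt_one_add_two_mul_sqrt_div h hu).deriv
  have hderiv₂ : deriv (deriv y) t
      = h⁻¹ * (-(1 / (2 * Real.sqrt t)) / Real.sqrt t ^ 2) := by
    rw [Filter.EventuallyEq.deriv_eq ((eventually_gt_nhds ht).mono hderiv)]
    exact (((Real.hasDerivAt_sqrt ht.ne').fun_inv hs).const_mul h⁻¹).deriv
  have hsq : t = Real.sqrt t ^ 2 := (Real.sq_sqrt ht.le).symm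
  have hsy : Real.sqrt t = h * (y t - 1) / 2 := by
    rw [hy]
    field_simp
    ring
  rw [hderiv₂, hderiv t ht]
  generalize y t = Y at *
  generalize Real.sqrt t = s at *
  have hY : Y - 1 ≠ 0 := by
    rintro h1
    simp [hsy, h1] at hs
  subst hsq hsy
  field_simp
  ring
end

section
/- Let u : ℝ → ℝ be twice differentiable on (0,∞) satisfying the degenerate confluent hypergeometric equation DW_{1/6}: u''(x) = (1/x − (2/9)/x²)·u(x) for all x > 0. Then the function v(z) = z^{−1}·u(z³/9) is twice differentiable on (0,∞) and satisfies the Airy equation v''(z) = z·v(z) for all z > 0. -/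
/-- The cubic substitution `x = z³/9`, `v(z) = z⁻¹·u(z³/9)` reduces the
degenerate confluent hypergeometric equation DW_{1/6} to the Airy equation
`v'' = z·v`. -/
theorem stmt_17 (u : ℝ → ℝ)
    (hu1 : ∀ x ∈ Set.Ioi (0 : ℝ), DifferentiableAt ℝ u x)
    (hu2 : ∀ x ∈ Set.Ioi (0 : ℝ), DifferentiableAt ℝ (deriv u) x)
    (hu : ∀ x ∈ Set.Ioi (0 : ℝ),
      deriv (deriv u) x = (1 / x - (2 / 9) / x ^ 2) * u x)
    (v : ℝ → ℝ)
    (hv : ∀ z ∈ Set.Ioi (0 : ℝ), v z = z⁻¹ * u (z ^ 3 / 9)) :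
    (∀ z ∈ Set.Ioi (0 : ℝ), DifferentiableAt ℝ v z) ∧
    (∀ z ∈ Set.Ioi (0 : ℝ), DifferentiableAt ℝ (deriv v) z) ∧
    (∀ z ∈ Set.Ioi (0 : ℝ), deriv (deriv v) z = z * v z) := by
  have hsub : ∀ z : ℝ, HasDerivAt (fun w : ℝ => w ^ 3 / 9) (z ^ 2 / 3) z := fun z => by
    refine ((hasDerivAt_pow 3 z).div_const 9).congr_deriv ?_
    norm_num
    ring
  have hpos : ∀ z ∈ Set.Ioi (0 : ℝ), z ^ 3 / 9 ∈ Set.Ioi (0 : ℝ) := fun z hz => by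
    have hz' : 0 < z := hz
    exact Set.mem_Ioi.mpr (by positivity)
  have hv1 : ∀ z ∈ Set.Ioi (0 : ℝ), HasDerivAt v
      (-(z ^ 2)⁻¹ * u (z ^ 3 / 9) + z / 3 * deriv u (z ^ 3 / 9)) z := fun z hz => by
    have hz0 : z ≠ 0 := ne_of_gt hz
    have hcomp := (hu1 _ (hpos z hz)).hasDerivAt.comp z (hsub z)
    have h := ((hasDerivAt_inv hz0).mul hcomp).congr_of_eventuallyEq
      (Filter.eventuallyEq_of_mem (Ioi_mem_nhds hz) hv)
    refine h.congr_deriv ?_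
    simp only [Function.comp_apply]
    field_simp
  have hv2 : ∀ z ∈ Set.Ioi (0 : ℝ), HasDerivAt (deriv v) (z * v z) z := fun z hz => by
    have hz0 : z ≠ 0 := ne_of_gt hz
    have hcomp := (hu1 _ (hpos z hz)).hasDerivAt.comp z (hsub z)
    have hcomp' := (hu2 _ (hpos z hz)).hasDerivAt.comp z (hsub z)
    have hinv := ((hasDerivAt_pow 2 z).fun_inv (pow_ne_zero 2 hz0)).fun_neg
    have h := ((hinv.mul hcomp).add (((hasDerivAt_id z).div_const 3).mul hcomp')).congr_of_eventuallyEq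
      (Filter.eventuallyEq_of_mem (Ioi_mem_nhds hz) fun w hw => (hv1 w hw).deriv)
    refine h.congr_deriv ?_
    rw [hu _ (hpos z hz), hv z hz]
    simp only [Function.comp_apply, id]
    push_cast
    field_simp
    ring
  exact ⟨fun z hz => (hv1 z hz).differentiableAt, fun z hz => (hv2 z hz).differentiableAt,
    fun z hz => (hv2 z hz).deriv⟩
end

section
/- Let t > 0 and let u : ℝ → ℝ be twice differentiable on (0,∞) satisfying the degenerate confluent hypergeometric equation DW_{1/6}: u''(x) = (1/x − (2/9)/x²)·u(x) for all x > 0. Then the function v(z) = (z(z²+t)²/6)^{−1/2}·u((z²+t)³/36) is twice differentiable on (0,∞) and satisfies v''(z) = (z⁴ + t·z² + 3/(4z²))·v(z) for all z > 0. -/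
/-- If `φ' = g`, `g' = g * l`, `p' = -(l / 2) * p` at `z` (so that `p` is a multiple of `g ^ (-1 / 2)`)
and `u'' = q * u` at `φ z`, then the derivative `p * (-(l / 2) * u ∘ φ + g * u' ∘ φ)` of `p * u ∘ φ`
has a derivative at `z` in which `u'` no longer occurs. -/
theorem hasDerivAt_liouville_transform {φ g l p u u' : ℝ → ℝ} {l' q z : ℝ}
    (hφ : HasDerivAt φ (g z) z) (hg : HasDerivAt g (g z * l z) z) (hl : HasDerivAt l l' z)
    (hp : HasDerivAt p (-(l z / 2) * p z) z) (hu : HasDerivAt u (u' (φ z)) (φ z))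
    (hu' : HasDerivAt u' (q * u (φ z)) (φ z)) :
    HasDerivAt (fun y => p y * (-(l y / 2) * u (φ y) + g y * u' (φ y)))
      ((g z ^ 2 * q + l z ^ 2 / 4 - l' / 2) * (p z * u (φ z))) z := by
  have h := hp.mul ((((hl.div_const 2).neg).mul (hu.comp z hφ)).add (hg.mul (hu'.comp z hφ)))
  refine h.congr_deriv ?_
  simp only [Pi.add_apply, Pi.mul_apply, Pi.neg_apply, Function.comp_apply]
  ring

/-- A function with logarithmic derivative `l` has `(-1 / 2)`-th power with logarithmic
derivative `-(l / 2)`. -/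
theorem HasDerivAt.rpow_neg_half {g : ℝ → ℝ} {l z : ℝ} (hg : HasDerivAt g (g z * l) z)
    (hpos : 0 < g z) :
    HasDerivAt (fun y => g y ^ (-(1 / 2) : ℝ)) (-(l / 2) * g z ^ (-(1 / 2) : ℝ)) z := by
  refine (hg.rpow_const (p := -(1 / 2)) (Or.inl hpos.ne')).congr_deriv ?_
  rw [Real.rpow_sub_one hpos.ne']
  field_simp

/-- The sextic substitution `x = (z²+t)³/36`,
`v(z) = (z(z²+t)²/6)^(−1/2)·u((z²+t)³/36)` transforms the degenerate
confluent hypergeometric equation DW_{1/6} into the isomonodromic linear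
equation `v'' = (z⁴ + t·z² + 3/(4z²))·v` of P2(0) at its rational
solution `q = 0`. -/
theorem stmt_19 (t : ℝ) (ht : 0 < t) (u : ℝ → ℝ)
    (hu1 : ∀ x ∈ Set.Ioi (0 : ℝ), DifferentiableAt ℝ u x)
    (hu2 : ∀ x ∈ Set.Ioi (0 : ℝ), DifferentiableAt ℝ (deriv u) x)
    (hu : ∀ x ∈ Set.Ioi (0 : ℝ),
      deriv (deriv u) x = (1 / x - (2 / 9) / x ^ 2) * u x)
    (v : ℝ → ℝ)
    (hv : ∀ z ∈ Set.Ioi (0 : ℝ),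
      v z = (z * (z ^ 2 + t) ^ 2 / 6) ^ (-(1 / 2) : ℝ)
        * u ((z ^ 2 + t) ^ 3 / 36)) :
    (∀ z ∈ Set.Ioi (0 : ℝ), DifferentiableAt ℝ v z) ∧
    (∀ z ∈ Set.Ioi (0 : ℝ), DifferentiableAt ℝ (deriv v) z) ∧
    (∀ z ∈ Set.Ioi (0 : ℝ),
      deriv (deriv v) z
        = (z ^ 4 + t * z ^ 2 + 3 / (4 * z ^ 2)) * v z) := by
  have hφpos : ∀ z : ℝ, 0 < (z ^ 2 + t) ^ 3 / 36 := fun z => by positivity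
  have hw : ∀ z : ℝ, z ^ 2 + t ≠ 0 := fun z => by positivity
  have hgpos : ∀ z : ℝ, 0 < z → 0 < z * (z ^ 2 + t) ^ 2 / 6 := fun z hz => by positivity
  have hdw : ∀ z : ℝ, HasDerivAt (fun y : ℝ => y ^ 2 + t) (2 * z) z := fun z => by
    simpa using (hasDerivAt_pow 2 z).add_const t
  have hφ : ∀ z : ℝ,
      HasDerivAt (fun y : ℝ => (y ^ 2 + t) ^ 3 / 36) (z * (z ^ 2 + t) ^ 2 / 6) z := fun z => by
    refine (((hdw z).pow 3).div_const 36).congr_deriv ?_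
    norm_num
    ring
  have hg : ∀ z : ℝ, 0 < z → HasDerivAt (fun y : ℝ => y * (y ^ 2 + t) ^ 2 / 6)
      (z * (z ^ 2 + t) ^ 2 / 6 * (1 / z + 4 * z / (z ^ 2 + t))) z := fun z hz => by
    refine (((hasDerivAt_id z).mul ((hdw z).pow 2)).div_const 6).congr_deriv ?_
    have := hw z
    simp only [id, Pi.pow_apply]
    field_simp
    norm_num
    ring
  have hl : ∀ z : ℝ, 0 < z → HasDerivAt (fun y : ℝ => 1 / y + 4 * y / (y ^ 2 + t))
      (-1 / z ^ 2 + 4 / (z ^ 2 + t) - 8 * z ^ 2 / (z ^ 2 + t) ^ 2) z := fun z hz => by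
    have := hw z
    refine (((hasDerivAt_const z (1 : ℝ)).div (hasDerivAt_id z) hz.ne').add
      (((hasDerivAt_id z).const_mul 4).div (hdw z) this)).congr_deriv ?_
    simp only [id]
    field_simp
    ring
  have hp := fun (z : ℝ) (hz : 0 < z) => (hg z hz).rpow_neg_half (hgpos z hz)
  have hu₁ := fun z : ℝ => (hu1 _ (hφpos z)).hasDerivAt
  have hu₂ := fun z : ℝ => (hu2 _ (hφpos z)).hasDerivAt.congr_deriv (hu _ (hφpos z))
  have hv₁ : ∀ z : ℝ, 0 < z → HasDerivAt v ((z * (z ^ 2 + t) ^ 2 / 6) ^ (-(1 / 2) : ℝ) *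
      (-((1 / z + 4 * z / (z ^ 2 + t)) / 2) * u ((z ^ 2 + t) ^ 3 / 36) +
        z * (z ^ 2 + t) ^ 2 / 6 * deriv u ((z ^ 2 + t) ^ 3 / 36))) z := fun z hz => by
    refine (((hp z hz).mul ((hu₁ z).comp z (hφ z))).congr_of_eventuallyEq
      (Filter.eventuallyEq_of_mem (Ioi_mem_nhds hz) hv)).congr_deriv ?_
    simp only [Function.comp_apply]
    ring
  have hv₂ : ∀ z : ℝ, 0 < z →
      HasDerivAt (deriv v) ((z ^ 4 + t * z ^ 2 + 3 / (4 * z ^ 2)) * v z) z := fun z hz => by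
    refine ((hasDerivAt_liouville_transform (hφ z) (hg z hz) (hl z hz) (hp z hz) (hu₁ z)
      (hu₂ z)).congr_of_eventuallyEq (Filter.eventuallyEq_of_mem (Ioi_mem_nhds hz)
        fun y hy => (hv₁ y hy).deriv)).congr_deriv ?_
    rw [hv z hz]
    congr 1
    have := hw z
    field_simp
    ring
  exact ⟨fun z hz => (hv₁ z hz).differentiableAt, fun z hz => (hv₂ z hz).differentiableAt,
    fun z hz => (hv₂ z hz).deriv⟩
end
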